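/- (Rogers' terminating ₆φ₅ sum) Let n be a nonnegative integer and let q, s, b, c be nonzero complex numbers (write a = s²) such that (q;q)_n ≠ 0, (s;q)_n ≠ 0, (−s;q)_n ≠ 0, (s²q/b;q)_n ≠ 0, (s²q/c;q)_n ≠ 0, (s²q^{n+1};q)_n ≠ 0, and (s²q/(bc);q)_n ≠ 0. Then ∑_{j=0}^{n} ((s²;q)_j (qs;q)_j (−qs;q)_j (b;q)_j (c;q)_j (q^{-n};q)_j / ((q;q)_j (s;q)_j (−s;q)_j (s²q/b;q)_j (s²q/c;q)_j (s²q^{n+1};q)_j)) · (s² q^{n+1}/(bc))^j = (s²q;q)_n (s²q/(bc);q)_n / ((s²q/b;q)_n (s²q/c;q)_n). -/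

import Mathlib

/-- The $q$-shifted factorial $(a;q)_m = \prod_{k=0}^{m-1}(1 - a q^k)$. -/
noncomputable def qPoch (q a : ℂ) (m : ℕ) : ℂ := ∏ k ∈ Finset.range m, (1 - a * q ^ k)

open Filter Topology in
/-- Near a nonzero `s`, every other point `z` satisfies `z ^ 2 * w ≠ 1`. -/
theorem eventually_sq_mul_ne_one {s : ℂ} (hs : s ≠ 0) (w : ℂ) :
    ∀ᶠ z in 𝓝[≠] s, z ^ 2 * w ≠ 1 := by
  by_cases h : s ^ 2 * w = 1
  · have hw : w ≠ 0 := right_ne_zero_of_mul (h.trans_ne one_ne_zero)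
    have hneg : ∀ᶠ z in 𝓝[≠] s, z ≠ -s :=
      nhdsWithin_le_nhds (isOpen_ne.mem_nhds (self_ne_neg.mpr hs))
    filter_upwards [hneg, self_mem_nhdsWithin] with z hz hzs hzw
    rcases sq_eq_sq_iff_eq_or_eq_neg.mp (mul_right_cancel₀ hw (hzw.trans h.symm)) with h' | h'
    · exact hzs h'
    · exact hz h'
  · have hc : ContinuousAt (fun z : ℂ => z ^ 2 * w) s := by fun_prop
    exact nhdsWithin_le_nhds (hc.eventually_ne h)

theorem qPoch_ne_zero_iff {q a : ℂ} {m : ℕ} :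
    qPoch q a m ≠ 0 ↔ ∀ k < m, a * q ^ k ≠ 1 := by
  simp only [qPoch, Finset.prod_ne_zero_iff, Finset.mem_range, sub_ne_zero, ne_comm (a := (1 : ℂ))]

theorem qPoch_succ (q a : ℂ) (m : ℕ) : qPoch q a (m + 1) = qPoch q a m * (1 - a * q ^ m) :=
  Finset.prod_range_succ _ _

theorem qPoch_ne_zero_mono {q a : ℂ} {m n : ℕ} (hmn : m ≤ n) (h : qPoch q a n ≠ 0) :
    qPoch q a m ≠ 0 :=
  qPoch_ne_zero_iff.mpr fun k hk => qPoch_ne_zero_iff.mp h k (hk.trans_le hmn)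

theorem continuous_qPoch (q : ℂ) (m : ℕ) : Continuous fun a => qPoch q a m := by
  unfold qPoch
  fun_prop

/-- The product part of the very-well-poised summand, with `B = 1 / b`, `C = 1 / c` and
`x = q ^ n`. -/
noncomputable def wpProd (q a B C x : ℂ) (j : ℕ) : ℂ :=
  ∏ k ∈ Finset.range j, ((1 - a * q ^ k) * (B - q ^ k) * (C - q ^ k) * (x - q ^ k) * (a * q) /
    ((1 - q ^ (k + 1)) * (1 - a * B * q ^ (k + 1)) * (1 - a * C * q ^ (k + 1)) *
      (1 - a * x * q ^ (k + 1))))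

/-- The very-well-poised summand. -/
noncomputable def wpTerm (q a B C x : ℂ) (j : ℕ) : ℂ :=
  (1 - a * q ^ (2 * j)) / (1 - a) * wpProd q a B C x j

/-- The product part of the telescoping antidifference. -/
noncomputable def wpCert (q a B C x : ℂ) (j : ℕ) : ℂ :=
  ∏ k ∈ Finset.range j, ((1 - a * q ^ (k + 1)) * (B - q ^ (k + 1)) * (C - q ^ (k + 1)) *
    (x - q ^ k) * (a * q) /
    ((1 - q ^ (k + 1)) * (1 - a * B * q ^ (k + 1)) * (1 - a * C * q ^ (k + 1)) *
      (1 - a * x * q ^ (k + 2))))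

theorem wpProd_succ_eq_wpCert {q a B C x : ℂ} (J : ℕ) :
    wpProd q a B C x (J + 1) = wpCert q a B C x J *
      ((1 - a) * (B - 1) * (C - 1) * (x - q ^ J) * (a * q) /
        ((1 - q ^ (J + 1)) * (1 - a * B * q ^ (J + 1)) * (1 - a * C * q ^ (J + 1)) *
          (1 - a * x * q))) := by
  induction J with
  | zero => simp [wpProd, wpCert]
  | succ J ih =>
    rw [wpProd, Finset.prod_range_succ, ← wpProd, ih, wpCert, wpCert, Finset.prod_range_succ]
    simp only [div_eq_mul_inv, mul_inv, show J + 1 + 1 = J + 2 from rfl]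
    ring

theorem wpProd_mul_succ_eq_wpCert {q a B C x : ℂ} (J : ℕ) :
    wpProd q a B C (x * q) (J + 1) = wpCert q a B C x J *
      ((1 - a) * (B - 1) * (C - 1) * (x * q - 1) * q ^ J * (a * q) /
        ((1 - q ^ (J + 1)) * (1 - a * B * q ^ (J + 1)) * (1 - a * C * q ^ (J + 1)) *
          (1 - a * x * q ^ (J + 2)))) := by
  induction J with
  | zero => simp [wpProd, wpCert]; ring
  | succ J ih =>
    rw [wpProd, Finset.prod_range_succ, ← wpProd, ih, wpCert, wpCert, Finset.prod_range_succ]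
    have e1 : x * q - q ^ (J + 1) = (x - q ^ J) * q := by ring
    have e2 : 1 - a * (x * q) * q ^ (J + 1 + 1) = 1 - a * x * q ^ (J + 1 + 2) := by ring
    rw [e1, e2]
    simp only [div_eq_mul_inv, mul_inv, pow_succ q J]
    ring

theorem sum_wpTerm_sub {q a B C x : ℂ} (J : ℕ) (ha : a ≠ 1)
    (hq : ∀ k < J, q ^ (k + 1) ≠ 1) (hB : ∀ k < J, a * B * q ^ (k + 1) ≠ 1)
    (hC : ∀ k < J, a * C * q ^ (k + 1) ≠ 1) (hx : ∀ k ≤ J, a * x * q ^ (k + 1) ≠ 1)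
    (hxB : a * B * x * q ≠ 1) (hxC : a * C * x * q ≠ 1) :
    ∑ j ∈ Finset.range (J + 1), (wpTerm q a B C (x * q) j -
      (1 - a * x * q) * (1 - a * B * C * x * q) /
        ((1 - a * B * x * q) * (1 - a * C * x * q)) * wpTerm q a B C x j) =
    a * x * q * (B - 1) * (C - 1) / ((1 - a * B * x * q) * (1 - a * C * x * q)) *
      wpCert q a B C x J := by
  have d1 : 1 - a ≠ 0 := sub_ne_zero.mpr ha.symm
  have d2 : 1 - a * B * x * q ≠ 0 := sub_ne_zero.mpr hxB.symm
  have d3 : 1 - a * C * x * q ≠ 0 := sub_ne_zero.mpr hxC.symm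
  induction J with
  | zero =>
    simp only [wpTerm, wpProd, wpCert, zero_add, Finset.sum_range_one, Finset.prod_range_zero,
      mul_zero, pow_zero, mul_one, div_self d1]
    generalize hD2 : 1 - a * B * x * q = D2 at *
    generalize hD3 : 1 - a * C * x * q = D3 at *
    field_simp
    subst hD2 hD3
    ring
  | succ J ih =>
    rw [Finset.sum_range_succ, ih (fun k hk => hq k (by lia)) (fun k hk => hB k (by lia))
      (fun k hk => hC k (by lia)) (fun k hk => hx k (by lia)), wpTerm, wpTerm,
      wpProd_mul_succ_eq_wpCert, wpProd_succ_eq_wpCert]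
    rw [show wpCert q a B C x (J + 1) = wpCert q a B C x J * _ from Finset.prod_range_succ _ _]
    have e1 : 1 - q ^ J * q ≠ 0 := sub_ne_zero.mpr (by simpa [pow_succ] using (hq J (by lia)).symm)
    have e2 : 1 - a * B * (q ^ J * q) ≠ 0 :=
      sub_ne_zero.mpr (by simpa [pow_succ] using (hB J (by lia)).symm)
    have e3 : 1 - a * C * (q ^ J * q) ≠ 0 :=
      sub_ne_zero.mpr (by simpa [pow_succ] using (hC J (by lia)).symm)
    have e4 : 1 - a * x * (q ^ J * q * q) ≠ 0 :=
      sub_ne_zero.mpr (by simpa [pow_succ] using (hx (J + 1) le_rfl).symm)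
    have e5 : 1 - a * x * q ≠ 0 := sub_ne_zero.mpr (by simpa using (hx 0 (by lia)).symm)
    rw [show 2 * (J + 1) = J + J + 2 by lia]
    simp only [pow_add, pow_one, pow_two]
    clear ih hq hB hC hx
    generalize q ^ J = y at *
    generalize wpCert q a B C x J = M at *
    simp only [← mul_assoc] at *
    generalize hD1 : 1 - a = D1 at *
    generalize hD2 : 1 - a * B * x * q = D2 at *
    generalize hD3 : 1 - a * C * x * q = D3 at *
    generalize hE1 : 1 - y * q = E1 at *
    generalize hE2 : 1 - a * B * y * q = E2 at *
    generalize hE3 : 1 - a * C * y * q = E3 at *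
    generalize hE4 : 1 - a * x * y * q * q = E4 at *
    generalize hE5 : 1 - a * x * q = E5 at *
    field_simp
    subst hD2 hD3 hE1 hE2 hE3 hE4
    ring

theorem sum_wpTerm (q a B C : ℂ) (n : ℕ) (ha : ∀ m ≤ 2 * n, a * q ^ m ≠ 1)
    (hq : ∀ k < n, q ^ (k + 1) ≠ 1) (hB : ∀ k < n, a * B * q ^ (k + 1) ≠ 1)
    (hC : ∀ k < n, a * C * q ^ (k + 1) ≠ 1) :
    ∑ j ∈ Finset.range (n + 1), wpTerm q a B C (q ^ n) j =
      ∏ k ∈ Finset.range n, ((1 - a * q ^ (k + 1)) * (1 - a * B * C * q ^ (k + 1)) /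
        ((1 - a * B * q ^ (k + 1)) * (1 - a * C * q ^ (k + 1)))) := by
  have ha1 : a ≠ 1 := by simpa using ha 0 (by lia)
  induction n with
  | zero => simp [wpTerm, wpProd, div_self (sub_ne_zero.mpr ha1.symm)]
  | succ n ih =>
    have key := sum_wpTerm_sub (x := q ^ n) (n + 1) ha1 hq hB hC
      (fun k hk => by
        have := ha (n + (k + 1)) (by lia)
        rwa [pow_add, ← mul_assoc] at this)
      (by have := hB n (by lia); rwa [pow_succ, ← mul_assoc] at this)
      (by have := hC n (by lia); rwa [pow_succ, ← mul_assoc] at this)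
    have hT : wpTerm q a B C (q ^ n) (n + 1) = 0 := by
      simp [wpTerm, wpProd, Finset.prod_range_succ]
    have hM : wpCert q a B C (q ^ n) (n + 1) = 0 := by
      simp [wpCert, Finset.prod_range_succ]
    rw [Finset.sum_sub_distrib, ← Finset.mul_sum, Finset.sum_range_succ (wpTerm q a B C (q ^ n)),
      hT, hM, add_zero, mul_zero, sub_eq_zero,
      ih (fun m hm => ha m (by lia)) (fun k hk => hq k (by lia)) (fun k hk => hB k (by lia))
        (fun k hk => hC k (by lia)), ← pow_succ] at key
    rw [key, Finset.prod_range_succ, mul_comm]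
    simp only [pow_succ, ← mul_assoc]

theorem qPoch_mul_qPoch_neg (q s : ℂ) (j : ℕ) :
    qPoch q (q * s) j * qPoch q (-(q * s)) j * (1 - s ^ 2) =
      qPoch q s j * qPoch q (-s) j * (1 - s ^ 2 * q ^ (2 * j)) := by
  induction j with
  | zero => simp [qPoch]
  | succ j ih =>
    simp only [qPoch_succ]
    linear_combination (1 - q * s * q ^ j) * (1 - -(q * s) * q ^ j) * ih

theorem rogers_summand_eq_wpTerm {n : ℕ} {q s b c : ℂ} (hq : q ≠ 0) (hb : b ≠ 0) (hc : c ≠ 0)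
    (j : ℕ) (hs : s ^ 2 ≠ 1) (h2 : qPoch q s j ≠ 0) (h3 : qPoch q (-s) j ≠ 0) :
    qPoch q (s ^ 2) j * qPoch q (q * s) j * qPoch q (-(q * s)) j * qPoch q b j *
        qPoch q c j * qPoch q (q ^ (-(n : ℤ))) j /
        (qPoch q q j * qPoch q s j * qPoch q (-s) j * qPoch q (s ^ 2 * q / b) j *
          qPoch q (s ^ 2 * q / c) j * qPoch q (s ^ 2 * q ^ (n + 1)) j) *
        (s ^ 2 * q ^ (n + 1) / (b * c)) ^ j = wpTerm q (s ^ 2) b⁻¹ c⁻¹ (q ^ n) j := by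
  have hs' : 1 - s ^ 2 ≠ 0 := sub_ne_zero.mpr hs.symm
  have hsplit : qPoch q (q * s) j * qPoch q (-(q * s)) j / (qPoch q s j * qPoch q (-s) j) =
      (1 - s ^ 2 * q ^ (2 * j)) / (1 - s ^ 2) := by
    rw [div_eq_div_iff (mul_ne_zero h2 h3) hs', qPoch_mul_qPoch_neg]
    ring
  have hprod : qPoch q (s ^ 2) j * qPoch q b j * qPoch q c j * qPoch q (q ^ (-(n : ℤ))) j /
      (qPoch q q j * qPoch q (s ^ 2 * q / b) j * qPoch q (s ^ 2 * q / c) j *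
        qPoch q (s ^ 2 * q ^ (n + 1)) j) * (s ^ 2 * q ^ (n + 1) / (b * c)) ^ j =
      wpProd q (s ^ 2) b⁻¹ c⁻¹ (q ^ n) j := by
    have hpow : (s ^ 2 * q ^ (n + 1) / (b * c)) ^ j =
        ∏ _k ∈ Finset.range j, (s ^ 2 * q ^ (n + 1) / (b * c)) := by
      rw [Finset.prod_const, Finset.card_range]
    rw [hpow]
    simp only [qPoch, wpProd, ← Finset.prod_mul_distrib, ← Finset.prod_div_distrib]
    refine Finset.prod_congr rfl fun k _ => ?_
    have hqn : q ^ n ≠ 0 := pow_ne_zero n hq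
    have f1 : b⁻¹ - q ^ k = (1 - b * q ^ k) / b := by field_simp
    have f2 : c⁻¹ - q ^ k = (1 - c * q ^ k) / c := by field_simp
    have f3 : q ^ n - q ^ k = (1 - q ^ (-(n : ℤ)) * q ^ k) * q ^ n := by
      rw [zpow_neg, zpow_natCast]
      field_simp
    have g1 : s ^ 2 * q / b * q ^ k = s ^ 2 * b⁻¹ * q ^ (k + 1) := by ring
    have g2 : s ^ 2 * q / c * q ^ k = s ^ 2 * c⁻¹ * q ^ (k + 1) := by ring
    have g3 : s ^ 2 * q ^ (n + 1) * q ^ k = s ^ 2 * q ^ n * q ^ (k + 1) := by ring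
    have g4 : q * q ^ k = q ^ (k + 1) := by ring
    rw [f1, f2, f3, g1, g2, g3, g4]
    simp only [div_eq_mul_inv, mul_inv, pow_succ q n]
    ring
  rw [wpTerm, ← hsplit, ← hprod]
  simp only [div_eq_mul_inv, mul_inv]
  ring

/-- The sum for generic `s`. -/
theorem rogers_6phi5_of_generic {n : ℕ} {q s b c : ℂ} (hq : q ≠ 0) (hb : b ≠ 0) (hc : c ≠ 0)
    (h1 : qPoch q q n ≠ 0) (h4 : qPoch q (s ^ 2 * q / b) n ≠ 0)
    (h5 : qPoch q (s ^ 2 * q / c) n ≠ 0) (hs : ∀ m ≤ 2 * n, s ^ 2 * q ^ m ≠ 1) :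
    ∑ j ∈ Finset.range (n + 1),
      qPoch q (s ^ 2) j * qPoch q (q * s) j * qPoch q (-(q * s)) j * qPoch q b j *
        qPoch q c j * qPoch q (q ^ (-(n : ℤ))) j /
        (qPoch q q j * qPoch q s j * qPoch q (-s) j * qPoch q (s ^ 2 * q / b) j *
          qPoch q (s ^ 2 * q / c) j * qPoch q (s ^ 2 * q ^ (n + 1)) j) *
        (s ^ 2 * q ^ (n + 1) / (b * c)) ^ j
    = qPoch q (s ^ 2 * q) n * qPoch q (s ^ 2 * q / (b * c)) n /
        (qPoch q (s ^ 2 * q / b) n * qPoch q (s ^ 2 * q / c) n) := by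
  have hsq : ∀ k < n, (s * q ^ k) ^ 2 ≠ 1 := fun k hk => by
    have := hs (k * 2) (by lia)
    rwa [pow_mul, ← mul_pow] at this
  have h2 : qPoch q s n ≠ 0 := qPoch_ne_zero_iff.mpr fun k hk h => hsq k hk (by simp [h])
  have h3 : qPoch q (-s) n ≠ 0 := qPoch_ne_zero_iff.mpr fun k hk h => hsq k hk (by
    rw [← neg_sq, ← neg_mul, h, one_pow])
  have g (u : ℂ) (k : ℕ) : s ^ 2 * q / u * q ^ k = s ^ 2 * u⁻¹ * q ^ (k + 1) := by ring
  rw [Finset.sum_congr rfl fun j hj => rogers_summand_eq_wpTerm hq hb hc j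
      (by simpa using hs 0 (by lia))
      (qPoch_ne_zero_mono (Finset.mem_range_succ_iff.mp hj) h2)
      (qPoch_ne_zero_mono (Finset.mem_range_succ_iff.mp hj) h3),
    sum_wpTerm q (s ^ 2) b⁻¹ c⁻¹ n hs
      (fun k hk => by simpa only [pow_succ'] using qPoch_ne_zero_iff.mp h1 k hk)
      (fun k hk => by simpa only [g] using qPoch_ne_zero_iff.mp h4 k hk)
      (fun k hk => by simpa only [g] using qPoch_ne_zero_iff.mp h5 k hk)]
  simp only [qPoch, ← Finset.prod_mul_distrib, ← Finset.prod_div_distrib]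
  refine Finset.prod_congr rfl fun k _ => ?_
  rw [g, g, g, mul_inv, ← mul_assoc, mul_assoc (s ^ 2) q, ← pow_succ']

open Filter Topology in
/-- Rogers' terminating ${}_6\phi_5$ sum, with $a = s^2$. -/
theorem rogers_6phi5 (n : ℕ) (q s b c : ℂ) (hq : q ≠ 0) (hs : s ≠ 0) (hb : b ≠ 0) (hc : c ≠ 0)
    (h1 : qPoch q q n ≠ 0) (h2 : qPoch q s n ≠ 0) (h3 : qPoch q (-s) n ≠ 0)
    (h4 : qPoch q (s ^ 2 * q / b) n ≠ 0) (h5 : qPoch q (s ^ 2 * q / c) n ≠ 0)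
    (h6 : qPoch q (s ^ 2 * q ^ (n + 1)) n ≠ 0) (h7 : qPoch q (s ^ 2 * q / (b * c)) n ≠ 0) :
    ∑ j ∈ Finset.range (n + 1),
      qPoch q (s ^ 2) j * qPoch q (q * s) j * qPoch q (-(q * s)) j * qPoch q b j *
        qPoch q c j * qPoch q (q ^ (-(n : ℤ))) j /
        (qPoch q q j * qPoch q s j * qPoch q (-s) j * qPoch q (s ^ 2 * q / b) j *
          qPoch q (s ^ 2 * q / c) j * qPoch q (s ^ 2 * q ^ (n + 1)) j) *
        (s ^ 2 * q ^ (n + 1) / (b * c)) ^ j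
    = qPoch q (s ^ 2 * q) n * qPoch q (s ^ 2 * q / (b * c)) n /
        (qPoch q (s ^ 2 * q / b) n * qPoch q (s ^ 2 * q / c) n) := by
  have hP (m : ℕ) {f : ℂ → ℂ} (hf : Continuous f) : ContinuousAt (fun z => qPoch q (f z) m) s :=
    ((continuous_qPoch q m).comp hf).continuousAt
  have ev4 := (hP n (f := fun z => z ^ 2 * q / b) (by fun_prop)).eventually_ne h4
  have ev5 := (hP n (f := fun z => z ^ 2 * q / c) (by fun_prop)).eventually_ne h5
  have evs : ∀ᶠ z in 𝓝[≠] s, ∀ m ∈ Set.Iic (2 * n), z ^ 2 * q ^ m ≠ 1 :=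
    (Set.finite_Iic (2 * n)).eventually_all.mpr fun m _ => eventually_sq_mul_ne_one hs (q ^ m)
  have hgen := (evs.and (nhdsWithin_le_nhds (ev4.and ev5))).mono fun z hz =>
    rogers_6phi5_of_generic hq hb hc h1 hz.2.1 hz.2.2 hz.1
  change (fun z => _) =ᶠ[𝓝[≠] s] (fun z => _) at hgen
  refine ((ContinuousAt.eventuallyEq_nhds_iff_eventuallyEq_nhdsNE ?_ ?_).mp hgen).eq_of_nhds
  · refine tendsto_finsetSum _ fun j hj => ?_
    have hj := Finset.mem_range_succ_iff.mp hj
    refine ContinuousAt.mul (ContinuousAt.div ?_ ?_ ?_) (by fun_prop)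
    · exact (((((hP j (by fun_prop)).mul (hP j (by fun_prop))).mul (hP j (by fun_prop))).mul
        (hP j (by fun_prop))).mul (hP j (by fun_prop))).mul (hP j (by fun_prop))
    · exact (((((hP j (by fun_prop)).mul (hP j (by fun_prop))).mul (hP j (by fun_prop))).mul
        (hP j (by fun_prop))).mul (hP j (by fun_prop))).mul (hP j (by fun_prop))
    · simp only [ne_eq, mul_eq_zero, not_or]
      exact ⟨⟨⟨⟨⟨qPoch_ne_zero_mono hj h1, qPoch_ne_zero_mono hj h2⟩, qPoch_ne_zero_mono hj h3⟩,
        qPoch_ne_zero_mono hj h4⟩, qPoch_ne_zero_mono hj h5⟩, qPoch_ne_zero_mono hj h6⟩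
  · exact ((hP n (by fun_prop)).mul (hP n (by fun_prop))).div
      ((hP n (by fun_prop)).mul (hP n (by fun_prop))) (mul_ne_zero h4 h5)
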